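/- Let m ≥ 1 be an integer and let m₁, m₂ ≥ 1 be integers with m̃ := m₁ + m₂ ≤ 2m. Fix partial derivative operators D₁ = ∂_x^{m₁₁}∂_y^{m₁₂} with m₁₁ + m₁₂ = m₁ and D₂ = ∂_x^{m₂₁}∂_y^{m₂₂} with m₂₁ + m₂₂ = m₂. Then there exists a constant c > 0, depending only on m, such that for every smooth periodic function u : ℝ² → ℝ, ‖(D₁u)(D₂u)‖ ≤ c ‖A^{m+1}u‖^{(m̃+1)/(2(m+1))} ‖u‖^{(4m−m̃+3)/(2(m+1))}. -/

import Mathlib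

open MeasureTheory Real Filter

noncomputable section

/-- A function `u : ℝ² → ℝ` is smooth periodic if it is `C^∞` and `2π`-periodic
in each variable. -/
def SmoothPeriodic (u : ℝ × ℝ → ℝ) : Prop :=
  ContDiff ℝ (⊤ : ℕ∞) u ∧ (∀ x y, u (x + 2 * Real.pi, y) = u (x, y)) ∧
    (∀ x y, u (x, y + 2 * Real.pi) = u (x, y))

/-- Partial derivative in the first variable. -/
def pdx (u : ℝ × ℝ → ℝ) : ℝ × ℝ → ℝ := fun p => fderiv ℝ u p (1, 0)

/-- Partial derivative in the second variable. -/
def pdy (u : ℝ × ℝ → ℝ) : ℝ × ℝ → ℝ := fun p => fderiv ℝ u p (0, 1)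

/-- The fundamental domain `[0, 2π]²`. -/
def sq2 : Set (ℝ × ℝ) := Set.Icc (0 : ℝ) (2 * Real.pi) ×ˢ Set.Icc (0 : ℝ) (2 * Real.pi)

/-- The `L²` inner product over `[0, 2π]²`. -/
def l2inner (u v : ℝ × ℝ → ℝ) : ℝ := ∫ p in sq2, u p * v p

/-- The `L²` norm over `[0, 2π]²`. -/
def l2norm (u : ℝ × ℝ → ℝ) : ℝ := Real.sqrt (∫ p in sq2, (u p) ^ 2)

/-- The `L^q` norm over `[0, 2π]²`. -/
def lpnorm (q : ℝ) (u : ℝ × ℝ → ℝ) : ℝ := (∫ p in sq2, |u p| ^ q) ^ (1 / q)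

/-- The operator `A = -Δ + 1`. -/
def Aop (u : ℝ × ℝ → ℝ) : ℝ × ℝ → ℝ :=
  fun p => -(pdx (pdx u) p + pdy (pdy u) p) + u p

/-- The pointwise dot product of gradients, `∇v ⋅ ∇w`. -/
def gradDot (v w : ℝ × ℝ → ℝ) : ℝ × ℝ → ℝ :=
  fun p => pdx v p * pdx w p + pdy v p * pdy w p

/-- The nonlinearity `f(u) = (a+3)u − 4Au + b|∇u|² + u³`. -/
def fNL (a b : ℝ) (u : ℝ × ℝ → ℝ) : ℝ × ℝ → ℝ :=
  fun p => (a + 3) * u p - 4 * Aop u p + b * gradDot u u p + (u p) ^ 3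

lemma contDiff_fderiv_apply_const {u : ℝ × ℝ → ℝ} (hu : ContDiff ℝ (⊤ : ℕ∞) u) (v : ℝ × ℝ) :
    ContDiff ℝ (⊤ : ℕ∞) fun p => fderiv ℝ u p v :=
  (hu.fderiv_right (m := (⊤ : ℕ∞)) (by simp)).clm_apply contDiff_const

lemma fderiv_add_eq_of_periodic {u : ℝ × ℝ → ℝ} {a : ℝ × ℝ} (h : ∀ p, u (p + a) = u p)
    (p : ℝ × ℝ) : fderiv ℝ u (p + a) = fderiv ℝ u p := by
  rw [← fderiv_comp_add_right, funext h]

lemma SmoothPeriodic.fderiv_apply {u : ℝ × ℝ → ℝ} (hu : SmoothPeriodic u) (v : ℝ × ℝ) :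
    SmoothPeriodic fun p => fderiv ℝ u p v := by
  refine ⟨contDiff_fderiv_apply_const hu.1 v, fun x y => ?_, fun x y => ?_⟩
  · have := fderiv_add_eq_of_periodic (u := u) (a := (2 * Real.pi, 0))
      (fun ⟨x, y⟩ => by simpa using hu.2.1 x y) (x, y)
    simp only [Prod.mk_add_mk, add_zero] at this
    simp only [this]
  · have := fderiv_add_eq_of_periodic (u := u) (a := (0, 2 * Real.pi))
      (fun ⟨x, y⟩ => by simpa using hu.2.2 x y) (x, y)
    simp only [Prod.mk_add_mk, add_zero] at this
    simp only [this]

/-- The space of smooth periodic functions on the plane. -/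
def smoothPeriodic : Submodule ℝ (ℝ × ℝ → ℝ) where
  carrier := {u | SmoothPeriodic u}
  add_mem' {u v} hu hv :=
    ⟨hu.1.add hv.1, fun x y => by simp [hu.2.1, hv.2.1], fun x y => by simp [hu.2.2, hv.2.2]⟩
  zero_mem' := ⟨contDiff_const, fun _ _ => rfl, fun _ _ => rfl⟩
  smul_mem' c u hu :=
    ⟨hu.1.const_smul c, fun x y => by simp [hu.2.1], fun x y => by simp [hu.2.2]⟩

namespace smoothPeriodic

lemma contDiff (u : smoothPeriodic) : ContDiff ℝ (⊤ : ℕ∞) (u : ℝ × ℝ → ℝ) := u.2.1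

lemma continuous (u : smoothPeriodic) : Continuous (u : ℝ × ℝ → ℝ) := (contDiff u).continuous

lemma differentiable (u : smoothPeriodic) : Differentiable ℝ (u : ℝ × ℝ → ℝ) :=
  (contDiff u).differentiable (by simp)

/-- Directional differentiation of smooth periodic functions. -/
def dirDeriv (v : ℝ × ℝ) : Module.End ℝ smoothPeriodic where
  toFun u := ⟨fun p => fderiv ℝ (u : ℝ × ℝ → ℝ) p v, SmoothPeriodic.fderiv_apply u.2 v⟩
  map_add' u w := by
    ext p
    simp [fderiv_add (differentiable u p) (differentiable w p)]
  map_smul' c u := by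
    ext p
    simp [fderiv_const_smul (differentiable u p)]

lemma commute_dirDeriv (v w : ℝ × ℝ) : Commute (dirDeriv v) (dirDeriv w) := by
  have key (v w : ℝ × ℝ) (u : smoothPeriodic) (p : ℝ × ℝ) :
      (dirDeriv v (dirDeriv w u) : ℝ × ℝ → ℝ) p
        = fderiv ℝ (fderiv ℝ (u : ℝ × ℝ → ℝ)) p v w := by
    have hd : DifferentiableAt ℝ (fderiv ℝ (u : ℝ × ℝ → ℝ)) p :=
      ((contDiff u).fderiv_right (m := 1) (by norm_cast)).differentiable (by simp) p
    change fderiv ℝ (fun q => fderiv ℝ (u : ℝ × ℝ → ℝ) q w) p v = _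
    rw [fderiv_clm_apply hd (differentiableAt_const w)]
    simp
  refine LinearMap.ext fun u => Subtype.ext (funext fun p => ?_)
  simp only [Module.End.mul_apply, key]
  refine (contDiff u).contDiffAt.isSymmSndFDerivAt ?_ v w
  simp only [minSmoothness_of_isRCLikeNormedField]
  exact WithTop.coe_le_coe.2 (le_top : (2 : ℕ∞) ≤ ⊤)

/-- Differentiation in the first variable. -/
abbrev derivX : Module.End ℝ smoothPeriodic := dirDeriv (1, 0)

/-- Differentiation in the second variable. -/
abbrev derivY : Module.End ℝ smoothPeriodic := dirDeriv (0, 1)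

/-- The operator `-Δ + 1` on smooth periodic functions. -/
def helmholtz : Module.End ℝ smoothPeriodic := 1 - derivX * derivX - derivY * derivY

lemma coe_derivX_pow (n : ℕ) (u : smoothPeriodic) :
    ((derivX ^ n) u : ℝ × ℝ → ℝ) = pdx^[n] u := by
  induction n with
  | zero => rfl
  | succ n ih => rw [pow_succ', Function.iterate_succ_apply', ← ih]; rfl

lemma coe_derivY_pow (n : ℕ) (u : smoothPeriodic) :
    ((derivY ^ n) u : ℝ × ℝ → ℝ) = pdy^[n] u := by
  induction n with
  | zero => rfl
  | succ n ih => rw [pow_succ', Function.iterate_succ_apply', ← ih]; rfl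

lemma coe_helmholtz (u : smoothPeriodic) : (helmholtz u : ℝ × ℝ → ℝ) = Aop u := by
  funext p
  change (u : ℝ × ℝ → ℝ) p - pdx (pdx u) p - pdy (pdy u) p = _
  simp only [Aop]
  ring

lemma coe_helmholtz_pow (n : ℕ) (u : smoothPeriodic) :
    ((helmholtz ^ n) u : ℝ × ℝ → ℝ) = Aop^[n] u := by
  induction n with
  | zero => rfl
  | succ n ih =>
    rw [pow_succ', Function.iterate_succ_apply', ← ih, Module.End.mul_apply, coe_helmholtz]

lemma commute_helmholtz_dirDeriv (v : ℝ × ℝ) : Commute helmholtz (dirDeriv v) := by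
  refine LinearMap.ext fun u => ?_
  have hX := LinearMap.congr_fun
    ((commute_dirDeriv (1, 0) v).mul_left (commute_dirDeriv (1, 0) v)).eq u
  have hY := LinearMap.congr_fun
    ((commute_dirDeriv (0, 1) v).mul_left (commute_dirDeriv (0, 1) v)).eq u
  simp only [Module.End.mul_apply] at hX hY
  simp only [helmholtz, Module.End.mul_apply, LinearMap.sub_apply, Module.End.one_apply, map_sub,
    hX, hY]

end smoothPeriodic

lemma Continuous.integrableOn_sq2 {f : ℝ × ℝ → ℝ} (hf : Continuous f) :
    IntegrableOn f sq2 :=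
  hf.continuousOn.integrableOn_compact (isCompact_Icc.prod isCompact_Icc)

lemma volume_restrict_sq2 : (volume.restrict sq2 : Measure (ℝ × ℝ)) =
    (volume.restrict (Set.Icc 0 (2 * Real.pi))).prod
      (volume.restrict (Set.Icc 0 (2 * Real.pi))) := by
  rw [Measure.prod_restrict, ← Measure.volume_eq_prod, sq2]

lemma setIntegral_sq2 {f : ℝ × ℝ → ℝ} (hf : Continuous f) :
    ∫ p in sq2, f p =
      ∫ x in Set.Icc 0 (2 * Real.pi), ∫ y in Set.Icc 0 (2 * Real.pi), f (x, y) := by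
  have h := hf.integrableOn_sq2
  rw [IntegrableOn, volume_restrict_sq2] at h
  rw [volume_restrict_sq2, integral_prod _ h]

lemma setIntegral_sq2_symm {f : ℝ × ℝ → ℝ} (hf : Continuous f) :
    ∫ p in sq2, f p =
      ∫ y in Set.Icc 0 (2 * Real.pi), ∫ x in Set.Icc 0 (2 * Real.pi), f (x, y) := by
  have h := hf.integrableOn_sq2
  rw [IntegrableOn, volume_restrict_sq2] at h
  rw [volume_restrict_sq2, integral_prod_symm _ h]

namespace smoothPeriodic

lemma hasDerivAt_left (u : smoothPeriodic) (x y : ℝ) :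
    HasDerivAt (fun t => (u : ℝ × ℝ → ℝ) (t, y)) ((derivX u : ℝ × ℝ → ℝ) (x, y)) x :=
  (differentiable u (x, y)).hasFDerivAt.comp_hasDerivAt x
    ((hasDerivAt_id x).prodMk (hasDerivAt_const x y))

lemma hasDerivAt_right (u : smoothPeriodic) (x y : ℝ) :
    HasDerivAt (fun t => (u : ℝ × ℝ → ℝ) (x, t)) ((derivY u : ℝ × ℝ → ℝ) (x, y)) y :=
  (differentiable u (x, y)).hasFDerivAt.comp_hasDerivAt y
    ((hasDerivAt_const y x).prodMk (hasDerivAt_id y))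

lemma setIntegral_Icc_eq_zero_of_hasDerivAt {f f' : ℝ → ℝ} {a b : ℝ} (hab : a ≤ b)
    (hf : ∀ t, HasDerivAt f (f' t) t) (hf' : Continuous f') (h : f b = f a) :
    ∫ t in Set.Icc a b, f' t = 0 := by
  rw [integral_Icc_eq_integral_Ioc, ← intervalIntegral.integral_of_le hab,
    intervalIntegral.integral_eq_sub_of_hasDerivAt (fun t _ => hf t)
      (hf'.intervalIntegrable _ _), h, sub_self]

lemma integral_mul_derivX (u v : smoothPeriodic) :
    ∫ p in sq2, (u : ℝ × ℝ → ℝ) p * (derivX v : ℝ × ℝ → ℝ) p =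
      -∫ p in sq2, (derivX u : ℝ × ℝ → ℝ) p * (v : ℝ × ℝ → ℝ) p := by
  have hc₁ : Continuous fun p => (derivX u : ℝ × ℝ → ℝ) p * (v : ℝ × ℝ → ℝ) p :=
    (continuous (derivX u)).mul (continuous v)
  have hc₂ : Continuous fun p => (u : ℝ × ℝ → ℝ) p * (derivX v : ℝ × ℝ → ℝ) p :=
    (continuous u).mul (continuous (derivX v))
  rw [eq_neg_iff_add_eq_zero, add_comm, ← integral_add hc₁.integrableOn_sq2 hc₂.integrableOn_sq2,
    setIntegral_sq2_symm (hc₁.fun_add hc₂)]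
  refine integral_eq_zero_of_ae (Eventually.of_forall fun y => ?_)
  refine setIntegral_Icc_eq_zero_of_hasDerivAt (by positivity)
    (fun t => (hasDerivAt_left u t y).mul (hasDerivAt_left v t y))
    ((hc₁.add hc₂).comp (by fun_prop : Continuous fun t : ℝ => (t, y))) ?_
  have hu := u.2.2.1 0 y
  have hv := v.2.2.1 0 y
  rw [zero_add] at hu hv
  simp [hu, hv]

lemma integral_mul_derivY (u v : smoothPeriodic) :
    ∫ p in sq2, (u : ℝ × ℝ → ℝ) p * (derivY v : ℝ × ℝ → ℝ) p =
      -∫ p in sq2, (derivY u : ℝ × ℝ → ℝ) p * (v : ℝ × ℝ → ℝ) p := by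
  have hc₁ : Continuous fun p => (derivY u : ℝ × ℝ → ℝ) p * (v : ℝ × ℝ → ℝ) p :=
    (continuous (derivY u)).mul (continuous v)
  have hc₂ : Continuous fun p => (u : ℝ × ℝ → ℝ) p * (derivY v : ℝ × ℝ → ℝ) p :=
    (continuous u).mul (continuous (derivY v))
  rw [eq_neg_iff_add_eq_zero, add_comm, ← integral_add hc₁.integrableOn_sq2 hc₂.integrableOn_sq2,
    setIntegral_sq2 (hc₁.fun_add hc₂)]
  refine integral_eq_zero_of_ae (Eventually.of_forall fun x => ?_)
  refine setIntegral_Icc_eq_zero_of_hasDerivAt (by positivity)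
    (fun t => (hasDerivAt_right u x t).mul (hasDerivAt_right v x t))
    ((hc₁.add hc₂).comp (by fun_prop : Continuous fun t : ℝ => (x, t))) ?_
  have hu := u.2.2.2 x 0
  have hv := v.2.2.2 x 0
  rw [zero_add] at hu hv
  simp [hu, hv]

/-- The `L²` inner product as a bilinear form on smooth periodic functions. -/
def l2form : LinearMap.BilinForm ℝ smoothPeriodic :=
  LinearMap.mk₂ ℝ (fun u v => ∫ p in sq2, (u : ℝ × ℝ → ℝ) p * (v : ℝ × ℝ → ℝ) p)
    (fun u₁ u₂ v => by
      simp only [Submodule.coe_add, Pi.add_apply, add_mul]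
      exact integral_add ((continuous u₁).mul (continuous v)).integrableOn_sq2
        ((continuous u₂).mul (continuous v)).integrableOn_sq2)
    (fun c u v => by
      simp only [Submodule.coe_smul, Pi.smul_apply, smul_eq_mul, mul_assoc]
      exact integral_const_mul _ _)
    (fun u v₁ v₂ => by
      simp only [Submodule.coe_add, Pi.add_apply, mul_add]
      exact integral_add ((continuous u).mul (continuous v₁)).integrableOn_sq2
        ((continuous u).mul (continuous v₂)).integrableOn_sq2)
    (fun c u v => by
      simp only [Submodule.coe_smul, Pi.smul_apply, smul_eq_mul, mul_left_comm _ c]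
      exact integral_const_mul _ _)

lemma l2form_apply (u v : smoothPeriodic) :
    l2form u v = ∫ p in sq2, (u : ℝ × ℝ → ℝ) p * (v : ℝ × ℝ → ℝ) p := rfl

lemma l2form_comm (u v : smoothPeriodic) : l2form u v = l2form v u := by
  simp only [l2form_apply, mul_comm]

lemma l2form_derivX_right (u v : smoothPeriodic) :
    l2form u (derivX v) = -l2form (derivX u) v := integral_mul_derivX u v

lemma l2form_derivY_right (u v : smoothPeriodic) :
    l2form u (derivY v) = -l2form (derivY u) v := integral_mul_derivY u v

lemma l2form_helmholtz_right (u v : smoothPeriodic) :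
    l2form u (helmholtz v) =
      l2form u v + l2form (derivX u) (derivX v) + l2form (derivY u) (derivY v) := by
  simp only [helmholtz, LinearMap.sub_apply, Module.End.mul_apply, Module.End.one_apply, map_sub]
  rw [l2form_derivX_right, l2form_derivY_right]
  ring

lemma l2form_helmholtz_comm (u v : smoothPeriodic) :
    l2form (helmholtz u) v = l2form u (helmholtz v) := by
  rw [l2form_comm, l2form_helmholtz_right, l2form_helmholtz_right, l2form_comm v,
    l2form_comm (derivX v), l2form_comm (derivY v)]

lemma l2form_helmholtz_pow_comm (n : ℕ) (u v : smoothPeriodic) :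
    l2form ((helmholtz ^ n) u) v = l2form u ((helmholtz ^ n) v) := by
  induction n generalizing u with
  | zero => rfl
  | succ n ih =>
    rw [pow_succ, Module.End.mul_apply, ih, l2form_helmholtz_comm, ← Module.End.mul_apply,
      ← pow_succ', pow_succ]

/-- The quadratic form `⟨u, A ^ s u⟩`, that is, the square of the `H ^ s` norm. -/
def energy (s : ℕ) (u : smoothPeriodic) : ℝ := l2form u ((helmholtz ^ s) u)

lemma energy_zero (u : smoothPeriodic) : energy 0 u = l2form u u := rfl

lemma energy_zero_nonneg (u : smoothPeriodic) : 0 ≤ energy 0 u :=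
  integral_nonneg fun _ => mul_self_nonneg _

lemma energy_succ (s : ℕ) (u : smoothPeriodic) :
    energy (s + 1) u = energy s u + energy s (derivX u) + energy s (derivY u) := by
  have hX := LinearMap.congr_fun ((commute_helmholtz_dirDeriv (1, 0)).pow_left s).eq u
  have hY := LinearMap.congr_fun ((commute_helmholtz_dirDeriv (0, 1)).pow_left s).eq u
  simp only [Module.End.mul_apply] at hX hY
  simp only [energy, pow_succ', Module.End.mul_apply, l2form_helmholtz_right, hX, hY]

lemma energy_nonneg (s : ℕ) (u : smoothPeriodic) : 0 ≤ energy s u := by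
  induction s generalizing u with
  | zero => exact energy_zero_nonneg u
  | succ s ih =>
    rw [energy_succ]
    have := ih u; have := ih (derivX u); have := ih (derivY u)
    positivity

lemma energy_le_succ (s : ℕ) (u : smoothPeriodic) : energy s u ≤ energy (s + 1) u := by
  rw [energy_succ]
  linarith [energy_nonneg s (derivX u), energy_nonneg s (derivY u)]

lemma energy_derivX_le (s : ℕ) (u : smoothPeriodic) : energy s (derivX u) ≤ energy (s + 1) u := by
  rw [energy_succ]
  linarith [energy_nonneg s u, energy_nonneg s (derivY u)]

lemma energy_derivY_le (s : ℕ) (u : smoothPeriodic) : energy s (derivY u) ≤ energy (s + 1) u := by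
  rw [energy_succ]
  linarith [energy_nonneg s u, energy_nonneg s (derivX u)]

lemma energy_derivX_pow_le (n s : ℕ) (u : smoothPeriodic) :
    energy s ((derivX ^ n) u) ≤ energy (s + n) u := by
  induction n generalizing s with
  | zero => rfl
  | succ n ih =>
    rw [pow_succ', Module.End.mul_apply, ← add_assoc, add_right_comm]
    exact (energy_derivX_le s _).trans (ih _)

lemma energy_derivY_pow_le (n s : ℕ) (u : smoothPeriodic) :
    energy s ((derivY ^ n) u) ≤ energy (s + n) u := by
  induction n generalizing s with
  | zero => rfl
  | succ n ih =>
    rw [pow_succ', Module.End.mul_apply, ← add_assoc, add_right_comm]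
    exact (energy_derivY_le s _).trans (ih _)

lemma energy_partial_le (s i j : ℕ) (u : smoothPeriodic) :
    energy s ((derivX ^ i) ((derivY ^ j) u)) ≤ energy (s + (i + j)) u := by
  rw [← add_assoc]
  exact (energy_derivX_pow_le i s _).trans (energy_derivY_pow_le j _ u)

lemma energy_two_mul (n : ℕ) (u : smoothPeriodic) :
    energy (2 * n) u = energy 0 ((helmholtz ^ n) u) := by
  rw [energy_zero, l2form_helmholtz_pow_comm, energy, ← Module.End.mul_apply, ← pow_add, two_mul]

lemma l2form_helmholtz_pow_sq_le (s : ℕ) (u v : smoothPeriodic) :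
    l2form u ((helmholtz ^ s) v) ^ 2 ≤ energy s u * energy s v := by
  have hexp (t : ℝ) : energy s (u + t • v) =
      energy s v * (t * t) + 2 * l2form u ((helmholtz ^ s) v) * t + energy s u := by
    have hsymm : l2form v ((helmholtz ^ s) u) = l2form u ((helmholtz ^ s) v) := by
      rw [l2form_comm, l2form_helmholtz_pow_comm]
    simp only [energy, map_add, map_smul, LinearMap.add_apply, LinearMap.smul_apply, smul_eq_mul,
      hsymm]
    ring
  have := discrim_le_zero fun t => (hexp t) ▸ energy_nonneg s (u + t • v)
  rw [discrim] at this
  linarith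

lemma energy_succ_sq_le (s : ℕ) (u : smoothPeriodic) :
    energy (s + 1) u ^ 2 ≤ energy s u * energy (s + 2) u := by
  have h := l2form_helmholtz_pow_sq_le s u (helmholtz u)
  have h₁ : (helmholtz ^ s) (helmholtz u) = (helmholtz ^ (s + 1)) u := by
    rw [pow_succ, Module.End.mul_apply]
  have h₂ : energy s (helmholtz u) = energy (s + 2) u := by
    rw [energy, l2form_helmholtz_comm, h₁, ← Module.End.mul_apply, ← pow_succ']
    rfl
  rwa [h₁, h₂] at h

end smoothPeriodic

lemma pow_succ_le_of_sq_le_mul {M : ℕ → ℝ} (h₀ : ∀ s, 0 ≤ M s)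
    (h : ∀ s, M (s + 1) ^ 2 ≤ M s * M (s + 2)) (s : ℕ) :
    M s ^ (s + 1) ≤ M (s + 1) ^ s * M 0 := by
  induction s with
  | zero => simp
  | succ s ih =>
    rcases (h₀ (s + 1)).eq_or_lt with hz | hpos
    · rw [← hz, zero_pow (by omega)]
      exact mul_nonneg (pow_nonneg (h₀ _) _) (h₀ 0)
    · refine le_of_mul_le_mul_left ?_ (pow_pos hpos s)
      calc M (s + 1) ^ s * M (s + 1) ^ (s + 1 + 1) = (M (s + 1) ^ 2) ^ (s + 1) := by ring
        _ ≤ (M s * M (s + 2)) ^ (s + 1) := pow_le_pow_left₀ (sq_nonneg _) (h s) _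
        _ = M s ^ (s + 1) * M (s + 2) ^ (s + 1) := mul_pow _ _ _
        _ ≤ M (s + 1) ^ s * M 0 * M (s + 2) ^ (s + 1) :=
          mul_le_mul_of_nonneg_right ih (pow_nonneg (h₀ _) _)
        _ = _ := by ring

/-- A nonnegative log-convex sequence satisfies the interpolation inequality. -/
lemma le_rpow_mul_rpow_of_sq_le_mul {M : ℕ → ℝ} (h₀ : ∀ s, 0 ≤ M s)
    (h : ∀ s, M (s + 1) ^ 2 ≤ M s * M (s + 2)) {s n : ℕ} (hs : 1 ≤ s) (hsn : s ≤ n) :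
    M s ≤ M n ^ ((s : ℝ) / n) * M 0 ^ (1 - (s : ℝ) / n) := by
  induction n, hsn using Nat.le_induction with
  | base =>
    have : (s : ℝ) ≠ 0 := by positivity
    simp [this]
  | succ n hsn ih =>
    have hn : (0 : ℝ) < n := by exact_mod_cast hs.trans hsn
    have hsn' : (s : ℝ) ≤ n := by exact_mod_cast hsn
    have hstep : M n ≤ M (n + 1) ^ ((n : ℝ) / (n + 1)) * M 0 ^ (1 / ((n : ℝ) + 1)) := by
      have h1 := Real.rpow_le_rpow (pow_nonneg (h₀ n) _) (pow_succ_le_of_sq_le_mul h₀ h n)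
        (by positivity : (0 : ℝ) ≤ 1 / ((n : ℝ) + 1))
      rw [Real.mul_rpow (pow_nonneg (h₀ _) _) (h₀ _), ← Real.rpow_natCast,
        ← Real.rpow_natCast, ← Real.rpow_mul (h₀ _), ← Real.rpow_mul (h₀ _)] at h1
      push_cast at h1
      rwa [mul_one_div_cancel (by positivity), Real.rpow_one, mul_one_div] at h1
    have hle : (s : ℝ) / n ≤ 1 := (div_le_one hn).2 hsn'
    calc M s ≤ M n ^ ((s : ℝ) / n) * M 0 ^ (1 - (s : ℝ) / n) := ih
      _ ≤ (M (n + 1) ^ ((n : ℝ) / (n + 1)) * M 0 ^ (1 / ((n : ℝ) + 1))) ^ ((s : ℝ) / n) *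
            M 0 ^ (1 - (s : ℝ) / n) :=
        mul_le_mul_of_nonneg_right (Real.rpow_le_rpow (h₀ n) hstep (by positivity))
          (Real.rpow_nonneg (h₀ 0) _)
      _ = M (n + 1) ^ ((s : ℝ) / ((n + 1 : ℕ) : ℝ)) *
            M 0 ^ (1 - (s : ℝ) / ((n + 1 : ℕ) : ℝ)) := by
        rw [Real.mul_rpow (Real.rpow_nonneg (h₀ _) _) (Real.rpow_nonneg (h₀ _) _),
          ← Real.rpow_mul (h₀ _), ← Real.rpow_mul (h₀ _), mul_assoc,
          ← Real.rpow_add_of_nonneg (h₀ 0) (by positivity) (by linarith)]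
        push_cast
        congr 2 <;> field_simp
        ring

/-- One-dimensional Sobolev embedding of `W^{1,1}` into `L^∞`. -/
lemma le_setIntegral_add_abs_of_hasDerivAt {f f' : ℝ → ℝ} {a b : ℝ} (hab : 1 ≤ b - a)
    (hf : ∀ t, HasDerivAt f (f' t) t) (hf' : Continuous f') (h₀ : ∀ t, 0 ≤ f t)
    {x : ℝ} (hx : x ∈ Set.Icc a b) : f x ≤ ∫ t in Set.Icc a b, (f t + |f' t|) := by
  have hcont : Continuous f := continuous_iff_continuousAt.2 fun t => (hf t).continuousAt
  obtain ⟨t₀, ht₀, hmin⟩ := isCompact_Icc.exists_isMinOn ⟨x, hx⟩ hcont.continuousOn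
  have hi : IntegrableOn f (Set.Icc a b) := hcont.continuousOn.integrableOn_compact isCompact_Icc
  have hi' : IntegrableOn (fun t => |f' t|) (Set.Icc a b) :=
    hf'.abs.continuousOn.integrableOn_compact isCompact_Icc
  have h₁ : f t₀ ≤ ∫ t in Set.Icc a b, f t := by
    have := setIntegral_mono_on (integrableOn_const (C := f t₀) (by simp)) hi measurableSet_Icc
      fun t ht => hmin ht
    rw [setIntegral_const, smul_eq_mul, Real.volume_real_Icc_of_le (by linarith)] at this
    nlinarith [h₀ t₀]
  have h₂ : f x - f t₀ ≤ ∫ t in Set.Icc a b, |f' t| := by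
    rw [← intervalIntegral.integral_eq_sub_of_hasDerivAt (fun t _ => hf t)
      (hf'.intervalIntegrable t₀ x)]
    refine (Real.le_norm_self _).trans ((intervalIntegral.norm_integral_le_integral_norm_uIoc).trans ?_)
    exact setIntegral_mono_set hi' (Eventually.of_forall fun t => abs_nonneg _)
      (Set.uIoc_subset_uIcc.trans (Set.uIcc_subset_Icc ht₀ hx)).eventuallyLE
  rw [integral_add hi hi']
  linarith

lemma one_le_two_pi_sub_zero : (1 : ℝ) ≤ 2 * Real.pi - 0 := by linarith [Real.pi_gt_three]

namespace smoothPeriodic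

lemma sq_le_integral_derivX (u : smoothPeriodic) {x : ℝ} (hx : x ∈ Set.Icc 0 (2 * Real.pi))
    (y : ℝ) : (u : ℝ × ℝ → ℝ) (x, y) ^ 2 ≤ ∫ t in Set.Icc 0 (2 * Real.pi),
      ((u : ℝ × ℝ → ℝ) (t, y) ^ 2 +
        |2 * (u : ℝ × ℝ → ℝ) (t, y) * (derivX u : ℝ × ℝ → ℝ) (t, y)|) := by
  have hcu := continuous u
  have hcd := continuous (derivX u)
  exact le_setIntegral_add_abs_of_hasDerivAt one_le_two_pi_sub_zero
    (fun t => by simpa using (hasDerivAt_left u t y).fun_pow 2) (by fun_prop)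
    (fun t => sq_nonneg _) hx

lemma sq_le_integral_derivY (u : smoothPeriodic) (x : ℝ) {y : ℝ}
    (hy : y ∈ Set.Icc 0 (2 * Real.pi)) :
    (u : ℝ × ℝ → ℝ) (x, y) ^ 2 ≤ ∫ t in Set.Icc 0 (2 * Real.pi),
      ((u : ℝ × ℝ → ℝ) (x, t) ^ 2 +
        |2 * (u : ℝ × ℝ → ℝ) (x, t) * (derivY u : ℝ × ℝ → ℝ) (x, t)|) := by
  have hcu := continuous u
  have hcd := continuous (derivY u)
  exact le_setIntegral_add_abs_of_hasDerivAt one_le_two_pi_sub_zero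
    (fun t => by simpa using (hasDerivAt_right u x t).fun_pow 2) (by fun_prop)
    (fun t => sq_nonneg _) hy

lemma integral_abs_mul_le (u v : smoothPeriodic) :
    ∫ p in sq2, |(u : ℝ × ℝ → ℝ) p * (v : ℝ × ℝ → ℝ) p| ≤ √(energy 0 u) * √(energy 0 v) := by
  have hcu := continuous u
  have hcv := continuous v
  have hexp (t : ℝ) : ∫ p in sq2, (|(u : ℝ × ℝ → ℝ) p| + t * |(v : ℝ × ℝ → ℝ) p|) ^ 2 =
      energy 0 v * (t * t) + 2 * (∫ p in sq2, |(u : ℝ × ℝ → ℝ) p * (v : ℝ × ℝ → ℝ) p|) * t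
        + energy 0 u := by
    simp only [energy_zero, l2form_apply]
    rw [mul_right_comm, ← integral_mul_const, ← integral_const_mul, ← integral_add,
      ← integral_add]
    · congr 1 with p
      rw [abs_mul, ← abs_mul_abs_self ((u : ℝ × ℝ → ℝ) p),
        ← abs_mul_abs_self ((v : ℝ × ℝ → ℝ) p)]
      ring
    all_goals exact Continuous.integrableOn_sq2 (by fun_prop)
  have := discrim_le_zero fun t => (hexp t) ▸ integral_nonneg fun p => sq_nonneg _
  rw [discrim] at this
  rw [← Real.sqrt_mul (energy_nonneg 0 u)]
  exact Real.le_sqrt_of_sq_le (by linarith)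

lemma integral_sq_add_abs_le (u v : smoothPeriodic) (hv : energy 0 v ≤ energy 1 u) :
    ∫ p in sq2, ((u : ℝ × ℝ → ℝ) p ^ 2 + |2 * (u : ℝ × ℝ → ℝ) p * (v : ℝ × ℝ → ℝ) p|) ≤
      3 * (√(energy 0 u) * √(energy 1 u)) := by
  have hcu := continuous u
  have hcv := continuous v
  have h₁ : ∫ p in sq2, (u : ℝ × ℝ → ℝ) p ^ 2 ≤ √(energy 0 u) * √(energy 1 u) := by
    calc ∫ p in sq2, (u : ℝ × ℝ → ℝ) p ^ 2 = energy 0 u := by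
          simp only [energy_zero, l2form_apply, sq]
      _ = √(energy 0 u) * √(energy 0 u) := (Real.mul_self_sqrt (energy_nonneg 0 u)).symm
      _ ≤ _ := by gcongr; exact energy_le_succ 0 u
  have h₂ : ∫ p in sq2, |(u : ℝ × ℝ → ℝ) p * (v : ℝ × ℝ → ℝ) p| ≤
      √(energy 0 u) * √(energy 1 u) :=
    (integral_abs_mul_le u v).trans (by gcongr)
  rw [integral_add (Continuous.integrableOn_sq2 (by fun_prop))
    (Continuous.integrableOn_sq2 (by fun_prop))]
  simp only [mul_assoc, abs_mul (2 : ℝ), abs_two]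
  rw [integral_const_mul]
  linarith

/-- A bilinear form of Ladyzhenskaya's inequality. -/
lemma integral_sq_mul_sq_le (u v : smoothPeriodic) :
    ∫ p in sq2, ((u : ℝ × ℝ → ℝ) p * (v : ℝ × ℝ → ℝ) p) ^ 2 ≤
      3 * (√(energy 0 u) * √(energy 1 u)) * (3 * (√(energy 0 v) * √(energy 1 v))) := by
  have hcu := continuous u
  have hcv := continuous v
  have hcx := continuous (derivX u)
  have hcy := continuous (derivY v)
  set F : ℝ × ℝ → ℝ := fun p => (u : ℝ × ℝ → ℝ) p ^ 2 +
    |2 * (u : ℝ × ℝ → ℝ) p * (derivX u : ℝ × ℝ → ℝ) p| with hF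
  set G : ℝ × ℝ → ℝ := fun p => (v : ℝ × ℝ → ℝ) p ^ 2 +
    |2 * (v : ℝ × ℝ → ℝ) p * (derivY v : ℝ × ℝ → ℝ) p| with hG
  have hFc : Continuous F := by fun_prop
  have hGc : Continuous G := by fun_prop
  have hFi := hFc.integrableOn_sq2
  have hGi := hGc.integrableOn_sq2
  rw [IntegrableOn, volume_restrict_sq2] at hFi hGi
  have hint := hGi.integral_prod_left.mul_prod hFi.integral_prod_right
  calc ∫ p in sq2, ((u : ℝ × ℝ → ℝ) p * (v : ℝ × ℝ → ℝ) p) ^ 2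
      ≤ ∫ p in sq2, (∫ t in Set.Icc 0 (2 * Real.pi), G (p.1, t)) *
          ∫ t in Set.Icc 0 (2 * Real.pi), F (t, p.2) := by
        rw [← volume_restrict_sq2] at hint
        refine setIntegral_mono_on (Continuous.integrableOn_sq2 (by fun_prop)) hint
          (measurableSet_Icc.prod measurableSet_Icc) fun p hp => ?_
        rw [mul_pow, mul_comm]
        have h₁ := sq_le_integral_derivY v p.1 hp.2
        have h₂ := sq_le_integral_derivX u hp.1 p.2
        exact mul_le_mul h₁ h₂ (sq_nonneg _) ((sq_nonneg _).trans h₁)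
    _ = (∫ p in sq2, G p) * ∫ p in sq2, F p := by
        rw [setIntegral_sq2 hGc, setIntegral_sq2_symm hFc, volume_restrict_sq2]
        exact integral_prod_mul (fun x => ∫ t in Set.Icc 0 (2 * Real.pi), G (x, t))
          fun y => ∫ t in Set.Icc 0 (2 * Real.pi), F (t, y)
    _ ≤ _ := by
        rw [mul_comm]
        exact mul_le_mul (integral_sq_add_abs_le u _ (energy_derivX_le 0 u))
          (integral_sq_add_abs_le v _ (energy_derivY_le 0 v))
          (integral_nonneg fun p => by positivity) (by positivity)

lemma sqrt_energy_zero (u : smoothPeriodic) : √(energy 0 u) = l2norm u := by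
  simp only [energy_zero, l2form_apply, l2norm, sq]

lemma sqrt_energy_le (n s : ℕ) (hs : 1 ≤ s) (hsn : s ≤ 2 * n) (u : smoothPeriodic) :
    √(energy s u) ≤ l2norm (Aop^[n] u) ^ ((s : ℝ) / (2 * n)) *
      l2norm u ^ (1 - (s : ℝ) / (2 * n)) := by
  have h := le_rpow_mul_rpow_of_sq_le_mul (fun s => energy_nonneg s u)
    (fun s => energy_succ_sq_le s u) hs hsn
  rw [energy_two_mul] at h
  push_cast at h
  rw [← coe_helmholtz_pow, ← sqrt_energy_zero, ← sqrt_energy_zero]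
  refine (Real.sqrt_le_sqrt h).trans_eq ?_
  rw [Real.sqrt_mul (Real.rpow_nonneg (energy_nonneg _ _) _)]
  simp only [Real.sqrt_eq_rpow]
  simp only [← Real.rpow_mul (energy_nonneg _ _), mul_comm]

end smoothPeriodic

/-- Gagliardo–Nirenberg type product estimate for two partial derivatives. -/
theorem stmt_3 (m : ℕ) (hm : 1 ≤ m) :
    ∃ c > 0, ∀ m₁ m₂ m₁₁ m₁₂ m₂₁ m₂₂ : ℕ,
      1 ≤ m₁ → 1 ≤ m₂ → m₁₁ + m₁₂ = m₁ → m₂₁ + m₂₂ = m₂ → m₁ + m₂ ≤ 2 * m →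
      ∀ u : ℝ × ℝ → ℝ, SmoothPeriodic u →
        l2norm (fun p => pdx^[m₁₁] (pdy^[m₁₂] u) p * pdx^[m₂₁] (pdy^[m₂₂] u) p) ≤
          c * l2norm (Aop^[m + 1] u) ^ ((((m₁ : ℝ) + (m₂ : ℝ)) + 1) / (2 * ((m : ℝ) + 1))) *
            l2norm u ^ ((4 * (m : ℝ) - ((m₁ : ℝ) + (m₂ : ℝ)) + 3) / (2 * ((m : ℝ) + 1))) := by
  refine ⟨3, by norm_num, ?_⟩
  rintro m₁ m₂ m₁₁ m₁₂ m₂₁ m₂₂ h₁ h₂ rfl rfl hle u hu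
  lift u to smoothPeriodic using hu
  rw [← smoothPeriodic.coe_derivY_pow, ← smoothPeriodic.coe_derivY_pow,
    ← smoothPeriodic.coe_derivX_pow, ← smoothPeriodic.coe_derivX_pow]
  set f := (smoothPeriodic.derivX ^ m₁₁) ((smoothPeriodic.derivY ^ m₁₂) u)
  set g := (smoothPeriodic.derivX ^ m₂₁) ((smoothPeriodic.derivY ^ m₂₂) u)
  set P := l2norm (Aop^[m + 1] u)
  set Q := l2norm u
  have hP : 0 ≤ P := Real.sqrt_nonneg _
  have hQ : 0 ≤ Q := Real.sqrt_nonneg _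
  have hm' : (0 : ℝ) < 2 * ((m : ℝ) + 1) := by positivity
  have interp (i j s : ℕ) (h1 : 1 ≤ s + (i + j)) (h2 : s + (i + j) ≤ 2 * (m + 1)) :
      √(smoothPeriodic.energy s ((smoothPeriodic.derivX ^ i) ((smoothPeriodic.derivY ^ j) u))) ≤
        P ^ (((s + (i + j) : ℕ) : ℝ) / (2 * ((m : ℝ) + 1))) *
          Q ^ (1 - ((s + (i + j) : ℕ) : ℝ) / (2 * ((m : ℝ) + 1))) := by
    have := smoothPeriodic.sqrt_energy_le (m + 1) _ h1 h2 u
    push_cast at this ⊢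
    exact (Real.sqrt_le_sqrt (smoothPeriodic.energy_partial_le s i j u)).trans this
  have hnn (s : ℕ) : 0 ≤ P ^ ((s : ℝ) / (2 * ((m : ℝ) + 1))) *
      Q ^ (1 - (s : ℝ) / (2 * ((m : ℝ) + 1))) := by positivity
  have hfrac (s : ℕ) (hs : s ≤ 2 * (m + 1)) : 0 ≤ 1 - (s : ℝ) / (2 * ((m : ℝ) + 1)) := by
    rw [sub_nonneg, div_le_one hm']
    exact_mod_cast hs
  refine Real.sqrt_le_iff.2 ⟨by positivity, (smoothPeriodic.integral_sq_mul_sq_le f g).trans ?_⟩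
  have hprod := mul_le_mul
    (mul_le_mul (interp m₁₁ m₁₂ 0 (by omega) (by omega)) (interp m₁₁ m₁₂ 1 (by omega) (by omega))
      (Real.sqrt_nonneg _) (hnn _))
    (mul_le_mul (interp m₂₁ m₂₂ 0 (by omega) (by omega)) (interp m₂₁ m₂₂ 1 (by omega) (by omega))
      (Real.sqrt_nonneg _) (hnn _)) (by positivity) (mul_nonneg (hnn _) (hnn _))
  calc 3 * (√(smoothPeriodic.energy 0 f) * √(smoothPeriodic.energy 1 f)) *
        (3 * (√(smoothPeriodic.energy 0 g) * √(smoothPeriodic.energy 1 g)))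
      = 9 * (√(smoothPeriodic.energy 0 f) * √(smoothPeriodic.energy 1 f) *
        (√(smoothPeriodic.energy 0 g) * √(smoothPeriodic.energy 1 g))) := by ring
    _ ≤ 9 * _ := mul_le_mul_of_nonneg_left hprod (by norm_num)
    _ = _ := by
      have regroup (a b c d a' b' c' d' : ℝ) : 9 * (a * a' * (b * b') * (c * c' * (d * d'))) =
          3 ^ 2 * (a * b * (c * d)) * (a' * b' * (c' * d')) := by ring
      have hf0 := hfrac (0 + (m₁₁ + m₁₂)) (by omega)
      have hf1 := hfrac (1 + (m₁₁ + m₁₂)) (by omega)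
      have hg0 := hfrac (0 + (m₂₁ + m₂₂)) (by omega)
      have hg1 := hfrac (1 + (m₂₁ + m₂₂)) (by omega)
      rw [mul_pow, mul_pow, ← Real.rpow_mul_natCast hP, ← Real.rpow_mul_natCast hQ,
        regroup,
        ← Real.rpow_add_of_nonneg hP (by positivity) (by positivity),
        ← Real.rpow_add_of_nonneg hP (by positivity) (by positivity),
        ← Real.rpow_add_of_nonneg hP (by positivity) (by positivity),
        ← Real.rpow_add_of_nonneg hQ hf0 hf1, ← Real.rpow_add_of_nonneg hQ hg0 hg1,
        ← Real.rpow_add_of_nonneg hQ (by positivity) (by positivity)]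
      push_cast
      congr 2
      · congr 1
        field_simp
        ring
      · field_simp
        ring
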